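/- arXiv:2201.13159 — 2 statements merged into one kernel-verified Lean document; each statement's English description precedes it below -/
import Mathlib

section
/- Let s ∈ (0,1) and P ∈ (0, ∞). Assume f : ℝ → ℝ is an odd, P-periodic, continuous function with f(x) ≥ 0 for all x ∈ (−P/2, 0), and f(x₀) > 0 for some x₀ ∈ (−P/2, 0). Then ∫_ℝ K_s(x−y)·f(y) dy > 0 for every x ∈ (−P/2, 0). -/
open MeasureTheory Set

/-- The Bessel kernel `K_s`. -/
noncomputable def besselKernel (s x : ℝ) : ℝ :=
  (1 / (2 * Real.sqrt Real.pi * Real.Gamma (s / 2))) *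
    ∫ t in Set.Ioi (0 : ℝ), Real.exp (-t - x ^ 2 / (4 * t)) * t ^ ((s - 3) / 2)

/-- A solution of the steady fKdV equation with wave speed `μ`: a bounded continuous
function satisfying the equation pointwise. -/
def IsFKdVSolution (s μ : ℝ) (φ : ℝ → ℝ) : Prop :=
  Continuous φ ∧ (∃ M, ∀ x, |φ x| ≤ M) ∧
    ∀ x, -μ * φ x + (φ x) ^ 2 / 2 + (∫ y, besselKernel s (x - y) * φ y) = 0


/-- integrand after the substitution `t = b u`, `b = x/2` -/
noncomputable def bkPhi (s u b : ℝ) : ℝ :=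
  Real.exp (-(b * (u + u⁻¹)) + ((s - 1) / 2) * Real.log b) * u ^ ((s - 3) / 2)

lemma bk_conv_aux (r c a d l : ℝ) (hr : r < 0) (ha : 0 < a) (had : a < d) (hl0 : 0 < l)
    (hl1 : l < 1) :
    Real.exp (-((l * a + (1 - l) * d) * c) + r * Real.log (l * a + (1 - l) * d)) <
      l * Real.exp (-(a * c) + r * Real.log a) + (1 - l) * Real.exp (-(d * c) + r * Real.log d) := by
  have h1 := strictConcaveOn_log_Ioi.2 (x := a) (y := d) ha (ha.trans had) had.ne hl0
    (sub_pos.2 hl1) (by ring)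
  have h2 := convexOn_exp.2 (x := -(a * c) + r * Real.log a) (y := -(d * c) + r * Real.log d)
    (mem_univ _) (mem_univ _) hl0.le (sub_pos.2 hl1).le (by ring)
  simp only [smul_eq_mul] at h1 h2
  refine lt_of_lt_of_le (Real.exp_lt_exp.2 ?_) h2
  nlinarith

lemma bk_conv4 (r c a b d : ℝ) (hr : r < 0) (ha : 0 < a) (hab : a < b) (hbd : b < d) :
    Real.exp (-(b * c) + r * Real.log b) + Real.exp (-((a + d - b) * c) + r * Real.log (a + d - b)) <
      Real.exp (-(a * c) + r * Real.log a) + Real.exp (-(d * c) + r * Real.log d) := by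
  have hda : 0 < d - a := by linarith
  have e1 : ((d - b) / (d - a)) * a + (1 - (d - b) / (d - a)) * d = b := by
    field_simp; ring
  have e2 : ((b - a) / (d - a)) * a + (1 - (b - a) / (d - a)) * d = a + d - b := by
    field_simp; ring
  have h1 := bk_conv_aux r c a d ((d - b) / (d - a)) hr ha (hab.trans hbd)
    (div_pos (by linarith) hda) ((div_lt_one hda).2 (by linarith))
  have h2 := bk_conv_aux r c a d ((b - a) / (d - a)) hr ha (hab.trans hbd)
    (div_pos (by linarith) hda) ((div_lt_one hda).2 (by linarith))
  rw [e1] at h1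
  rw [e2] at h2
  have e3 : (b - a) / (d - a) = 1 - (d - b) / (d - a) := by
    field_simp; ring
  rw [e3] at h2
  linarith

lemma bkPhi_integrable (s b : ℝ) (hs : 0 < s) (hb : 0 < b) :
    IntegrableOn (fun u => bkPhi s u b) (Ioi 0) := by
  have h0 := integrableOn_rpow_mul_exp_neg_mul_rpow (p := 1) (s := (s - 3) / 2 + 2) (b := b)
    (by linarith) one_pos hb
  have h1 := h0.const_mul (Real.exp ((s - 1) / 2 * Real.log b) * (2 / b ^ 2))
  refine Integrable.mono' h1 ?_ ?_
  · apply Measurable.aestronglyMeasurable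
    unfold bkPhi
    fun_prop
  · refine (ae_restrict_mem measurableSet_Ioi).mono fun u hu => ?_
    have hu : 0 < u := hu
    unfold bkPhi
    rw [Real.norm_of_nonneg (by positivity), Real.rpow_add hu, Real.rpow_two, Real.rpow_one]
    have hy : 0 < b * u⁻¹ := by positivity
    have hq := Real.quadratic_le_exp_of_nonneg hy.le
    have hq2 : Real.exp (-(b * u⁻¹)) ≤ 2 / b ^ 2 * u ^ 2 := by
      rw [Real.exp_neg]
      apply inv_le_of_inv_le₀ (by positivity)
      have : (2 / b ^ 2 * u ^ 2)⁻¹ = (b * u⁻¹) ^ 2 / 2 := by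
        field_simp
      rw [this]; linarith
    have e : Real.exp (-(b * (u + u⁻¹)) + (s - 1) / 2 * Real.log b)
        = Real.exp (-b * u) * Real.exp ((s - 1) / 2 * Real.log b) * Real.exp (-(b * u⁻¹)) := by
      rw [← Real.exp_add, ← Real.exp_add]; congr 1; ring
    rw [e]
    calc _ ≤ Real.exp (-b * u) * Real.exp ((s - 1) / 2 * Real.log b) * (2 / b ^ 2 * u ^ 2)
            * u ^ ((s - 3) / 2) := by gcongr
      _ = _ := by ring

lemma besselKernel_eq (s x : ℝ) (hx : 0 < x) :
    besselKernel s x = (1 / (2 * Real.sqrt Real.pi * Real.Gamma (s / 2))) *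
      ∫ u in Ioi (0 : ℝ), bkPhi s u (x / 2) := by
  unfold besselKernel
  congr 1
  have hb : 0 < x / 2 := by positivity
  have h := integral_comp_mul_left_Ioi'
    (fun t => Real.exp (-t - x ^ 2 / (4 * t)) * t ^ ((s - 3) / 2)) 0 hb
  rw [mul_zero] at h
  rw [← h, smul_eq_mul, ← integral_const_mul]
  refine setIntegral_congr_fun measurableSet_Ioi fun u hu => ?_
  have hu : 0 < u := hu
  have e : (s - 1) / 2 = (s - 3) / 2 + 1 := by ring
  simp only [bkPhi]
  rw [Real.mul_rpow hb.le hu.le, Real.exp_add, mul_comm ((s - 1) / 2), ← Real.rpow_def_of_pos hb,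
    e, Real.rpow_add hb, Real.rpow_one]
  have e2 : -(x / 2 * u) - x ^ 2 / (4 * (x / 2 * u)) = -(x / 2 * (u + u⁻¹)) := by
    field_simp; ring
  rw [e2]; ring

lemma besselKernel_even (s x : ℝ) : besselKernel s (-x) = besselKernel s x := by
  simp [besselKernel]

lemma besselKernel_conv4 (s a b d : ℝ) (hs : s ∈ Ioo (0 : ℝ) 1) (ha : 0 < a) (hab : a < b)
    (hbd : b < d) :
    besselKernel s b + besselKernel s (a + d - b) < besselKernel s a + besselKernel s d := by
  have hC : 0 < 1 / (2 * Real.sqrt Real.pi * Real.Gamma (s / 2)) := by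
    have := Real.Gamma_pos_of_pos (half_pos hs.1)
    positivity
  rw [besselKernel_eq s b (by linarith), besselKernel_eq s _ (by linarith : 0 < a + d - b),
    besselKernel_eq s a ha, besselKernel_eq s d (by linarith), ← mul_add, ← mul_add]
  refine mul_lt_mul_of_pos_left ?_ hC
  have ia := bkPhi_integrable s (a / 2) hs.1 (by linarith)
  have ib := bkPhi_integrable s (b / 2) hs.1 (by linarith)
  have ic := bkPhi_integrable s ((a + d - b) / 2) hs.1 (by linarith)
  have id := bkPhi_integrable s (d / 2) hs.1 (by linarith)
  rw [← integral_add ib ic, ← integral_add ia id, ← sub_pos,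
    ← integral_sub (by exact ia.add id) (by exact ib.add ic)]
  have hp : ∀ u ∈ Ioi (0 : ℝ), 0 < (bkPhi s u (a / 2) + bkPhi s u (d / 2)) -
      (bkPhi s u (b / 2) + bkPhi s u ((a + d - b) / 2)) := by
    intro u hu
    have hu : 0 < u := hu
    have h := bk_conv4 ((s - 1) / 2) (u + u⁻¹) (a / 2) (b / 2) (d / 2) (by linarith [hs.2])
      (by linarith) (by linarith) (by linarith)
    rw [show a / 2 + d / 2 - b / 2 = (a + d - b) / 2 by ring] at h
    have hq : 0 < u ^ ((s - 3) / 2) := by positivity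
    simp only [bkPhi]
    nlinarith
  rw [setIntegral_pos_iff_support_of_nonneg_ae]
  · have : Ioi (0 : ℝ) ⊆ Function.support (fun u => (bkPhi s u (a / 2) + bkPhi s u (d / 2)) -
      (bkPhi s u (b / 2) + bkPhi s u ((a + d - b) / 2))) ∩ Ioi 0 :=
      fun u hu => ⟨(hp u hu).ne', hu⟩
    refine lt_of_lt_of_le ?_ (measure_mono this)
    simp
  · exact (ae_restrict_mem measurableSet_Ioi).mono fun u hu => (hp u hu).le
  · exact (ia.add id).sub (ib.add ic)

lemma besselKernel_integrable (s : ℝ) (hs : 0 < s) : Integrable (besselKernel s) := by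
  have key : Integrable (fun p : ℝ × ℝ =>
      Real.exp (-p.2 - p.1 ^ 2 / (4 * p.2)) * p.2 ^ ((s - 3) / 2))
      ((volume : Measure ℝ).prod (volume.restrict (Ioi (0 : ℝ)))) := by
    have e : ∀ t : ℝ, (fun x : ℝ => Real.exp (-t - x ^ 2 / (4 * t)) * t ^ ((s - 3) / 2))
        = fun x => (Real.exp (-t) * t ^ ((s - 3) / 2)) * Real.exp (-(1 / (4 * t)) * x ^ 2) := by
      intro t; funext x
      rw [sub_eq_add_neg, Real.exp_add,
        show -(x ^ 2 / (4 * t)) = -(1 / (4 * t)) * x ^ 2 by ring]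
      ring
    rw [integrable_prod_iff' (by apply Measurable.aestronglyMeasurable; fun_prop)]
    constructor
    · refine (ae_restrict_mem measurableSet_Ioi).mono fun t ht => ?_
      have ht : 0 < t := ht
      simp only [e]
      exact (integrable_exp_neg_mul_sq (by positivity)).const_mul _
    · have h0 := integrableOn_rpow_mul_exp_neg_mul_rpow (p := 1) (s := s / 2 - 1) (b := 1)
        (by linarith) one_pos one_pos
      have h1 := h0.const_mul (Real.sqrt (4 * Real.pi))
      refine Integrable.congr h1 ?_
      refine (ae_restrict_mem measurableSet_Ioi).mono fun t ht => ?_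
      have ht : 0 < t := ht
      have : ∀ x : ℝ, ‖Real.exp (-t - x ^ 2 / (4 * t)) * t ^ ((s - 3) / 2)‖ =
          Real.exp (-t - x ^ 2 / (4 * t)) * t ^ ((s - 3) / 2) := fun x =>
        Real.norm_of_nonneg (by positivity)
      simp only [this]
      rw [e, integral_const_mul, integral_gaussian]
      rw [show Real.pi / (1 / (4 * t)) = 4 * Real.pi * t by field_simp,
        Real.sqrt_mul (by positivity : 0 ≤ 4 * Real.pi) t, Real.sqrt_eq_rpow t,
        show s / 2 - 1 = (s - 3) / 2 + 1 / 2 by ring, Real.rpow_add ht, Real.rpow_one]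
      simp only [neg_mul, one_mul]
      ring
  exact key.integral_prod_left.const_mul _

lemma bk_half (G H : ℝ → ℝ) (u v : ℝ) (huv : u ≤ v) (hH : Continuous H)
    (hi : IntervalIntegrable (fun z => G z * H z) volume u v)
    (hodd : ∀ z, H (u + v - z) = -H z)
    (hp : ∀ z ∈ Ioo u v, H z ≠ 0 → 0 < (G z - G (u + v - z)) * H z) :
    0 ≤ (∫ z in u..v, G z * H z) ∧
      ((∃ z ∈ Ioo u v, H z ≠ 0) → 0 < ∫ z in u..v, G z * H z) := by
  have hi2 : IntervalIntegrable (fun z => G (u + v - z) * H (u + v - z)) volume u v := by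
    have := (hi.comp_sub_left (u + v)).symm
    simpa using this
  have hr : (∫ z in u..v, G (u + v - z) * H (u + v - z)) = ∫ z in u..v, G z * H z := by
    have := intervalIntegral.integral_comp_sub_left (a := u) (b := v) (fun z => G z * H z) (u + v)
    simpa using this
  have e : (fun z => (G z - G (u + v - z)) * H z) =
      fun z => G z * H z + G (u + v - z) * H (u + v - z) := by
    funext z; rw [hodd]; ring
  have hi3 : IntervalIntegrable (fun z => (G z - G (u + v - z)) * H z) volume u v := by
    rw [e]; exact hi.add hi2
  have h2 : 2 * (∫ z in u..v, G z * H z) = ∫ z in Ioo u v, (G z - G (u + v - z)) * H z := by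
    rw [← integral_Ioc_eq_integral_Ioo, ← intervalIntegral.integral_of_le huv, e,
      intervalIntegral.integral_add hi hi2, hr]
    ring
  have hn : ∀ z ∈ Ioo u v, 0 ≤ (G z - G (u + v - z)) * H z := by
    intro z hz
    by_cases h : H z = 0
    · simp [h]
    · exact (hp z hz h).le
  constructor
  · have := setIntegral_nonneg (μ := volume) measurableSet_Ioo hn
    linarith
  · rintro ⟨z, hz, hHz⟩
    have : 0 < ∫ z in Ioo u v, (G z - G (u + v - z)) * H z := by
      rw [setIntegral_pos_iff_support_of_nonneg_ae]
      · have hsub : {z | H z ≠ 0} ∩ Ioo u v ⊆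
            Function.support (fun z => (G z - G (u + v - z)) * H z) ∩ Ioo u v :=
          fun w hw => ⟨(hp w hw.2 hw.1).ne', hw.2⟩
        refine lt_of_lt_of_le ?_ (measure_mono hsub)
        have ho : IsOpen ({z | H z ≠ 0} ∩ Ioo u v) :=
          (isOpen_ne_fun hH continuous_const).inter isOpen_Ioo
        exact ho.measure_pos _ ⟨z, hHz, hz⟩
      · exact (ae_restrict_mem measurableSet_Ioo).mono fun z hz => hn z hz
      · exact ((intervalIntegrable_iff_integrableOn_Ioc_of_le huv).1 hi3).mono_set
          Ioo_subset_Ioc_self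
    linarith

lemma bk_period (P : ℝ) (hP : 0 < P) (f : ℝ → ℝ) (hf : Continuous f)
    (hodd : ∀ x, f (-x) = -f x) (hper : Function.Periodic f P)
    (hnonneg : ∀ x ∈ Ioo (-(P / 2)) (0 : ℝ), 0 ≤ f x)
    (hpos : ∃ x₀ ∈ Ioo (-(P / 2)) (0 : ℝ), 0 < f x₀) (x : ℝ) (hx : x ∈ Ioo (-(P / 2)) (0 : ℝ))
    (G : ℝ → ℝ) (hG : ∀ z, G (P - z) = G z)
    (hanti : ∀ a b, 0 < a → a < b → a < P - b → G b < G a)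
    (hi : ∀ u v, IntervalIntegrable (fun z => G z * f (x - z)) volume u v) :
    0 < ∫ z in (0 : ℝ)..P, G z * f (x - z) := by
  obtain ⟨hx1, hx2⟩ := hx
  -- a positivity point different from `x`
  obtain ⟨y, hy, hyx, hfy⟩ : ∃ y ∈ Ioo (-(P / 2)) (0 : ℝ), y ≠ x ∧ 0 < f y := by
    obtain ⟨x₀, hx₀, hfx₀⟩ := hpos
    have h1 : ∀ᶠ y in nhds x₀, y ∈ Ioo (-(P / 2)) (0 : ℝ) ∧ 0 < f y :=
      Filter.Eventually.and (isOpen_Ioo.mem_nhds hx₀) (hf.continuousAt.eventually (lt_mem_nhds hfx₀))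
    by_cases h : x₀ = x
    · have h2 : ∀ᶠ y in nhdsWithin x₀ {x₀}ᶜ, y ≠ x₀ := eventually_mem_nhdsWithin
      obtain ⟨y, hy, hy'⟩ := ((h1.filter_mono nhdsWithin_le_nhds).and h2).exists
      exact ⟨y, hy.1, h ▸ hy', hy.2⟩
    · exact ⟨x₀, hx₀, h, hfx₀⟩
  have hH : Continuous fun z => f (x - z) := by fun_prop
  have A := bk_half G (fun z => f (x - z)) 0 (P + 2 * x) (by linarith) hH (hi _ _)
    (fun z => by
      show f _ = - f _
      rw [← hodd, ← hper (x - (0 + (P + 2 * x) - z))]; congr 1; ring)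
    (by
      intro z hz hne
      obtain ⟨hz0, hz1⟩ := hz
      rcases lt_trichotomy z (P / 2 + x) with h | h | h
      · have h1 := hnonneg (x - z) ⟨by linarith, by linarith⟩
        have h2 := hanti z (0 + (P + 2 * x) - z) hz0 (by linarith) (by linarith)
        exact mul_pos (by linarith) (lt_of_le_of_ne h1 (Ne.symm hne))
      · exfalso; apply hne
        have h1 : f (x - z) = f (-(x - z)) := by
          rw [← hper (x - z)]; congr 1; rw [h]; ring
        rw [hodd] at h1
        show f (x - z) = 0
        linarith
      · have h1 := hnonneg (z - x - P) ⟨by linarith, by linarith⟩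
        have h2 := hanti (0 + (P + 2 * x) - z) z (by linarith) (by linarith) (by linarith)
        have h3 : f (z - x - P) = - f (x - z) := by
          rw [← hodd, ← hper (z - x - P)]; congr 1; ring
        have h4 : f (x - z) < 0 := lt_of_le_of_ne (by linarith) hne
        exact mul_pos_of_neg_of_neg (by linarith) h4)
  have B := bk_half G (fun z => f (x - z)) (P + 2 * x) P (by linarith) hH (hi _ _)
    (fun z => by
      show f _ = - f _
      rw [← hodd, ← hper (x - (P + 2 * x + P - z)), ← hper (x - (P + 2 * x + P - z) + P)]
      congr 1; ring)
    (by
      intro z hz hne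
      obtain ⟨hz0, hz1⟩ := hz
      rcases lt_trichotomy z (P + x) with h | h | h
      · have h1 := hnonneg (z - x - P) ⟨by linarith, by linarith⟩
        have h2 := hanti (P - (P + 2 * x + P - z)) z (by linarith) (by linarith) (by linarith)
        rw [hG] at h2
        have h3 : f (z - x - P) = - f (x - z) := by
          rw [← hodd, ← hper (z - x - P)]; congr 1; ring
        have h4 : f (x - z) < 0 := lt_of_le_of_ne (by linarith) hne
        exact mul_pos_of_neg_of_neg (by linarith) h4
      · exfalso; apply hne
        have h1 : f (x - z) = f 0 := by
          rw [← hper (x - z)]; congr 1; rw [h]; ring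
        have h0 := hodd 0
        rw [neg_zero] at h0
        show f (x - z) = 0
        linarith
      · have h1 := hnonneg (x - z + P) ⟨by linarith, by linarith⟩
        rw [hper] at h1
        have h2 := hanti (P - z) (P + 2 * x + P - z) (by linarith) (by linarith) (by linarith)
        rw [hG] at h2
        exact mul_pos (by linarith) (lt_of_le_of_ne h1 (Ne.symm hne)))
  rw [← intervalIntegral.integral_add_adjacent_intervals (hi 0 (P + 2 * x)) (hi (P + 2 * x) P)]
  rcases lt_or_gt_of_ne hyx with h | h
  · have := A.2 ⟨x - y, ⟨by linarith, by linarith [hy.1]⟩, by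
      simp only [sub_sub_cancel]; exact hfy.ne'⟩
    linarith [B.1]
  · have := B.2 ⟨x - y + P, ⟨by linarith [hy.2], by linarith [hy.1]⟩, by
      have : f (x - (x - y + P)) = f y := by rw [← hper (x - (x - y + P))]; congr 1; ring
      simp only [this]; exact hfy.ne'⟩
    linarith [A.1]

/-- The Bessel convolution of an odd, periodic, nonnegative-on-half-period function is
strictly positive on the half period. -/
theorem besselKernel_convolution_pos_of_odd (s P : ℝ) (hs : s ∈ Set.Ioo (0 : ℝ) 1)
    (hP : 0 < P) (f : ℝ → ℝ) (hf : Continuous f) (hodd : ∀ x, f (-x) = -f x)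
    (hper : Function.Periodic f P)
    (hnonneg : ∀ x ∈ Set.Ioo (-(P / 2)) (0 : ℝ), 0 ≤ f x)
    (hpos : ∃ x₀ ∈ Set.Ioo (-(P / 2)) (0 : ℝ), 0 < f x₀) :
    ∀ x ∈ Set.Ioo (-(P / 2)) (0 : ℝ), 0 < ∫ y, besselKernel s (x - y) * f y := by
  intro x hx
  have hK := besselKernel_integrable s hs.1
  obtain ⟨M, hM⟩ : ∃ M, ∀ y, ‖f y‖ ≤ M := by
    obtain ⟨M, hM⟩ := (hper.isBounded_of_continuous hP.ne' hf).exists_norm_le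
    exact ⟨M, fun y => hM _ (mem_range_self y)⟩
  have hbm : ∀ g : ℝ → ℝ, Integrable g → Integrable fun z => g z * f (x - z) := by
    intro g hg
    have hc : Continuous fun z => f (x - z) := by fun_prop
    have := hg.bdd_mul (c := M) hc.aestronglyMeasurable (ae_of_all _ fun z => hM (x - z))
    simpa only [mul_comm] using this
  have hF := hbm _ hK
  have h1 : (∫ y, besselKernel s (x - y) * f y) = ∫ z, besselKernel s z * f (x - z) := by
    rw [← integral_sub_left_eq_self (fun z => besselKernel s z * f (x - z)) volume x]
    simp
  rw [h1]
  set F : ℝ → ℝ := fun z => besselKernel s z * f (x - z) with hFdef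
  have hs2 := (hF.comp_mul_left' hP.ne').hasSum_intervalIntegral_comp_add_int.nat_add_neg_add_one
  have h3 : (∫ z, F (P * z)) = P⁻¹ * ∫ z, F z := by
    rw [Measure.integral_comp_mul_left, abs_of_pos (inv_pos.2 hP), smul_eq_mul]
  rw [h3] at hs2
  have hshift : ∀ n : ℤ, (∫ z in (0 : ℝ)..1, F (P * (z + n))) =
      P⁻¹ * ∫ z in (0 : ℝ)..P, besselKernel s (z + n * P) * f (x - z) := by
    intro n
    have h := intervalIntegral.integral_comp_mul_left (a := 0) (b := 1)
      (fun w => F (w + n * P)) hP.ne'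
    rw [mul_zero, mul_one, smul_eq_mul] at h
    have e : ∀ z, F (P * (z + n)) = F (P * z + n * P) := fun z => by congr 1; ring
    simp only [e]
    rw [h]
    congr 2
    funext w
    simp only [hFdef]
    congr 1
    have := hper.sub_int_mul_eq (x := x - w) n
    rw [← this]; congr 1; ring
  have hterm : ∀ n : ℕ, 0 < (∫ z in (0 : ℝ)..1, F (P * (z + ((n : ℤ) : ℝ)))) +
      ∫ z in (0 : ℝ)..1, F (P * (z + ((-((n : ℤ) + 1) : ℤ) : ℝ))) := by
    intro n
    rw [hshift, hshift, ← mul_add]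
    refine mul_pos (inv_pos.2 hP) ?_
    have i1 := hbm _ (hK.comp_add_right (((n : ℤ) : ℝ) * P))
    have i2 := hbm _ (hK.comp_add_right (((-((n : ℤ) + 1) : ℤ) : ℝ) * P))
    rw [← intervalIntegral.integral_add i1.intervalIntegrable i2.intervalIntegrable]
    simp only [← add_mul]
    have hn : (0 : ℝ) ≤ n * P := by positivity
    apply bk_period P hP f hf hodd hper hnonneg hpos x hx
      (fun z => besselKernel s (z + ((n : ℤ) : ℝ) * P) +
        besselKernel s (z + ((-((n : ℤ) + 1) : ℤ) : ℝ) * P))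
    · intro z
      rw [add_comm]
      congr 1
      · rw [← besselKernel_even]; congr 1; push_cast; ring
      · rw [← besselKernel_even]; congr 1; push_cast; ring
    · intro a b ha hab haP
      have h := besselKernel_conv4 s (a + n * P) (b + n * P) ((n + 1) * P - a) hs
        (by linarith) (by linarith) (by nlinarith)
      rw [← besselKernel_even s (b + _), ← besselKernel_even s (a + ((-((n : ℤ) + 1) : ℤ) : ℝ) * P)]
      rw [besselKernel_even s (b + _), ← besselKernel_even s (b + ((-((n : ℤ) + 1) : ℤ) : ℝ) * P)]
      convert h using 3 <;> push_cast <;> ring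
    · intro u v
      have := (i1.add i2).intervalIntegrable (a := u) (b := v)
      refine this.congr ?_
      intro z _
      simp only [Pi.add_apply]
      ring
  have h0 : 0 < P⁻¹ * ∫ z, F z :=
    hasSum_lt (fun n => (hterm n).le) (hterm 0) hasSum_zero hs2
  exact pos_of_mul_pos_right h0 (inv_pos.2 hP).le
end

section
/- Let s ∈ (0,1), μ ∈ ℝ, and let φ be a solution of the steady fKdV equation with wave speed μ. If μ ≤ 1, then either φ ≡ 2(μ−1) on ℝ, or 2(μ−1) ≤ inf_{x∈ℝ} φ(x) ≤ 0 ≤ sup_{x∈ℝ} φ(x). If μ > 1, then either φ ≡ 0 on ℝ, or 0 ≤ inf_{x∈ℝ} φ(x) ≤ 2(μ−1) ≤ sup_{x∈ℝ} φ(x). -/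
open MeasureTheory Set

/-- The integrand of the Bessel kernel, as a function of `(x, t)`. -/
noncomputable def besselIntegrand (s : ℝ) (p : ℝ × ℝ) : ℝ :=
  Real.exp (-p.2 - p.1 ^ 2 / (4 * p.2)) * p.2 ^ ((s - 3) / 2)

lemma besselIntegrand_eq (s t x : ℝ) : besselIntegrand s (x, t) =
    (Real.exp (-t) * t ^ ((s - 3) / 2)) * Real.exp (-(1 / (4 * t)) * x ^ 2) := by
  unfold besselIntegrand
  have : -t - x ^ 2 / (4 * t) = -t + -(1 / (4 * t)) * x ^ 2 := by ring
  simp only [this, Real.exp_add]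
  ring

lemma besselIntegrand_nonneg (s x t : ℝ) (ht : 0 < t) : 0 ≤ besselIntegrand s (x, t) := by
  unfold besselIntegrand
  positivity

lemma besselIntegrand_slice (s t : ℝ) (ht : 0 < t) :
    ∫ x, besselIntegrand s (x, t) =
      2 * Real.sqrt Real.pi * (Real.exp (-t) * t ^ (s / 2 - 1)) := by
  simp only [besselIntegrand_eq]
  rw [integral_const_mul, integral_gaussian]
  have h1 : Real.pi / (1 / (4 * t)) = Real.pi * (2 ^ 2 * t) := by field_simp; norm_num
  rw [h1, Real.sqrt_mul Real.pi_pos.le, Real.sqrt_mul (by norm_num), Real.sqrt_sq (by norm_num),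
    Real.sqrt_eq_rpow t]
  have h2 : s / 2 - 1 = (s - 3) / 2 + 1 / 2 := by ring
  rw [h2, Real.rpow_add ht]
  ring

lemma besselIntegrand_integrable (s : ℝ) (hs : 0 < s) :
    Integrable (besselIntegrand s)
      ((volume : Measure ℝ).prod (volume.restrict (Ioi (0 : ℝ)))) := by
  have hm : Measurable (besselIntegrand s) := by
    unfold besselIntegrand
    fun_prop
  rw [integrable_prod_iff' hm.aestronglyMeasurable]
  constructor
  · refine (ae_restrict_iff' measurableSet_Ioi).2 (Filter.Eventually.of_forall fun t ht => ?_)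
    simp only [besselIntegrand_eq]
    exact (integrable_exp_neg_mul_sq (by have : 0 < t := ht; positivity)).const_mul _
  · have h := (Real.GammaIntegral_convergent (s := s / 2) (by positivity)).const_mul
      (2 * Real.sqrt Real.pi)
    refine Integrable.congr h ?_
    refine (ae_restrict_iff' measurableSet_Ioi).2 (Filter.Eventually.of_forall fun t ht => ?_)
    have ht : 0 < t := ht
    simp only [Real.norm_of_nonneg (besselIntegrand_nonneg s _ t ht)]
    exact (besselIntegrand_slice s t ht).symm

lemma besselKernel_nonneg (s x : ℝ) (hs : 0 < s) : 0 ≤ besselKernel s x := by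
  unfold besselKernel
  have := Real.Gamma_pos_of_pos (s := s / 2) (by positivity)
  refine mul_nonneg (by positivity) (setIntegral_nonneg measurableSet_Ioi fun t ht => ?_)
  exact besselIntegrand_nonneg s x t ht

lemma besselKernel_integral (s : ℝ) (hs : 0 < s) : ∫ x, besselKernel s x = 1 := by
  have hG := Real.Gamma_pos_of_pos (s := s / 2) (by positivity)
  have h1 : ∫ x, ∫ t in Ioi (0 : ℝ), besselIntegrand s (x, t) =
      2 * Real.sqrt Real.pi * Real.Gamma (s / 2) := by
    rw [integral_integral_swap (f := fun x t => besselIntegrand s (x, t))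
      (besselIntegrand_integrable s hs),
      setIntegral_congr_fun measurableSet_Ioi (fun t ht => besselIntegrand_slice s t ht),
      integral_const_mul, Real.Gamma_eq_integral (by positivity)]
  have h2 : ∀ x, besselKernel s x = (1 / (2 * Real.sqrt Real.pi * Real.Gamma (s / 2))) *
    ∫ t in Ioi (0 : ℝ), besselIntegrand s (x, t) := fun x => rfl
  simp only [h2]
  rw [integral_const_mul, h1]
  have := Real.pi_pos
  field_simp

lemma bessel_conv_bounds (s : ℝ) (hs : 0 < s) (φ : ℝ → ℝ) (hc : Continuous φ) (a b : ℝ)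
    (ha : ∀ y, a ≤ φ y) (hb : ∀ y, φ y ≤ b) (x : ℝ) :
    a ≤ (∫ y, besselKernel s (x - y) * φ y) ∧ (∫ y, besselKernel s (x - y) * φ y) ≤ b := by
  have hK : Integrable (fun y => besselKernel s (x - y)) :=
    (besselKernel_integrable s hs).comp_sub_left x
  have hK1 : ∫ y, besselKernel s (x - y) = 1 := by
    rw [integral_sub_left_eq_self (besselKernel s) volume x, besselKernel_integral s hs]
  have hI : Integrable (fun y => besselKernel s (x - y) * φ y) := by
    refine hK.mul_bdd (c := max |a| |b|) hc.aestronglyMeasurable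
      (Filter.Eventually.of_forall fun y => ?_)
    exact abs_le_max_abs_abs (ha y) (hb y)
  have e : ∀ c : ℝ, ∫ y, besselKernel s (x - y) * c = c := fun c => by
    rw [integral_mul_const, hK1, one_mul]
  constructor
  · rw [← e a]
    exact (integral_mono (hK.mul_const a) hI fun y =>
      mul_le_mul_of_nonneg_left (ha y) (besselKernel_nonneg s _ hs)).trans_eq (by simp only [e a])
  · rw [← e b]
    exact (by simp only [e b] : _ = _).trans_le (integral_mono hI (hK.mul_const b) fun y =>
      mul_le_mul_of_nonneg_left (hb y) (besselKernel_nonneg s _ hs))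

/-- A priori bounds on the infimum and supremum of fKdV traveling waves. -/
theorem fKdV_inf_sup_bounds (s μ : ℝ) (hs : s ∈ Set.Ioo (0 : ℝ) 1)
    (φ : ℝ → ℝ) (hφ : IsFKdVSolution s μ φ) :
    (μ ≤ 1 → (∀ x, φ x = 2 * (μ - 1)) ∨
      (2 * (μ - 1) ≤ ⨅ x, φ x ∧ (⨅ x, φ x) ≤ 0 ∧ 0 ≤ ⨆ x, φ x)) ∧
    (1 < μ → (∀ x, φ x = 0) ∨
      (0 ≤ ⨅ x, φ x ∧ (⨅ x, φ x) ≤ 2 * (μ - 1) ∧ 2 * (μ - 1) ≤ ⨆ x, φ x)) := by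
  obtain ⟨hc, ⟨B, hB⟩, heq⟩ := hφ
  have hbb : BddBelow (range φ) := ⟨-B, by rintro _ ⟨x, rfl⟩; exact (abs_le.1 (hB x)).1⟩
  have hba : BddAbove (range φ) := ⟨B, by rintro _ ⟨x, rfl⟩; exact (abs_le.1 (hB x)).2⟩
  have hlo : ∀ x, (⨅ x, φ x) ≤ φ x := fun x => ciInf_le hbb x
  have hhi : ∀ x, φ x ≤ ⨆ x, φ x := fun x => le_ciSup hba x
  have hconv := bessel_conv_bounds s hs.1 φ hc _ _ hlo hhi
  have hm : (⨅ x, φ x) ∈ closure (range φ) := csInf_mem_closure (range_nonempty φ) hbb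
  have hM : (⨆ x, φ x) ∈ closure (range φ) := csSup_mem_closure (range_nonempty φ) hba
  generalize (⨅ x, φ x) = m at *
  generalize (⨆ x, φ x) = M at *
  have hm' : m ≤ μ * m - m ^ 2 / 2 := by
    have hcl : IsClosed {z : ℝ | m ≤ μ * z - z ^ 2 / 2} :=
      isClosed_le (by fun_prop) (by fun_prop)
    refine closure_minimal ?_ hcl hm
    rintro _ ⟨x, rfl⟩
    have := heq x
    have := (hconv x).1
    simp only [mem_setOf_eq]
    linarith
  have hM' : μ * M - M ^ 2 / 2 ≤ M := by
    have hcl : IsClosed {z : ℝ | μ * z - z ^ 2 / 2 ≤ M} :=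
      isClosed_le (by fun_prop) (by fun_prop)
    refine closure_minimal ?_ hcl hM
    rintro _ ⟨x, rfl⟩
    have := heq x
    have := (hconv x).2
    simp only [mem_setOf_eq]
    linarith
  refine ⟨fun hμ => ?_, fun hμ => ?_⟩
  · have h1 : 2 * (μ - 1) ≤ m := by
      by_contra! h
      nlinarith
    have h2 : m ≤ 0 := by
      by_contra! h
      nlinarith
    rcases le_or_gt 0 M with h | h
    · exact Or.inr ⟨h1, h2, h⟩
    · left
      have h3 : M ≤ 2 * (μ - 1) := by
        by_contra! h'
        nlinarith
      intro x
      linarith [hlo x, hhi x]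
  · have h1 : 0 ≤ m := by
      by_contra! h
      nlinarith
    have h2 : m ≤ 2 * (μ - 1) := by
      by_contra! h
      nlinarith
    rcases le_or_gt (2 * (μ - 1)) M with h | h
    · exact Or.inr ⟨h1, h2, h⟩
    · left
      have h3 : M ≤ 0 := by
        by_contra! h'
        nlinarith
      intro x
      linarith [hlo x, hhi x]
end
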